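/- There are no integers a, b with b even and 2 ≤ b < a such that 6ab − 3b² − 14a − 2b = 0. -/

import Mathlib

theorem stmt_6 :
    ¬ ∃ a b : ℤ, Even b ∧ 2 ≤ b ∧ b < a ∧ 6*a*b - 3*b^2 - 14*a - 2*b = 0 := by
  rintro ⟨a, b, hb, h2, hlt, h⟩
  have hb4 : b ≤ 4 := by
    by_contra! h5
    nlinarith [mul_pos (sub_pos.2 hlt) (show 0 < 6 * b - 14 by linarith)]
  interval_cases b
  · omega
  · exact absurd hb (by decide)
  · omega
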